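/- Let 0 < s < 1 and let K be a fixed n×n complex matrix. Then the function F(A,B) = Trace(A^s K* B^{1-s} K) is jointly concave on pairs of positive definite n×n complex matrices: if A₁, A₂, B₁, B₂ are positive definite and 0 ≤ c ≤ 1, then F(cA₁ + (1-c)A₂, cB₁ + (1-c)B₂) ≥ c·F(A₁,B₁) + (1-c)·F(A₂,B₂). (Lieb's concavity theorem.) -/

import Mathlib

open Matrix
open scoped ComplexOrder

/-- The real power `A ^ s` of a matrix, via the continuous functional calculus. -/
noncomputable def matrixRpow {k : ℕ} (A : Matrix (Fin k) (Fin k) ℂ) (s : ℝ) :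
    Matrix (Fin k) (Fin k) ℂ :=
  cfc (fun x : ℝ => x ^ s) A

namespace LiebConcavity

open MeasureTheory Real Set

variable {ι : Type*} {A B : Matrix ι ι ℂ}

lemma posDef_convex_combination (hA : A.PosDef) (hB : B.PosDef) {c : ℝ} (hc0 : 0 ≤ c)
    (hc1 : c ≤ 1) : (c • A + (1 - c) • B).PosDef := by
  rcases hc0.eq_or_lt with rfl | hc
  · simpa using hB
  · exact (hA.smul hc).add_posSemidef (hB.posSemidef.smul (sub_nonneg.2 hc1))

variable [Fintype ι]

/-- A form linear in `(A, B)` whose minimum over `X + Y = K` is the trace functional attached to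
the parallel sum `a b / (a + t b)`. -/
noncomputable def splitForm (t : ℝ) (A B X Y : Matrix ι ι ℂ) : ℝ :=
  t⁻¹ * ((A * Xᴴ * X).trace).re + ((Yᴴ * B * Y).trace).re

lemma splitForm_add_smul (t c d : ℝ) (A₁ A₂ B₁ B₂ X Y : Matrix ι ι ℂ) :
    splitForm t (c • A₁ + d • A₂) (c • B₁ + d • B₂) X Y
      = c * splitForm t A₁ B₁ X Y + d * splitForm t A₂ B₂ X Y := by
  simp only [splitForm, Matrix.add_mul, Matrix.mul_add, Matrix.smul_mul, Matrix.mul_smul,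
    Matrix.trace_add, Matrix.trace_smul, Complex.add_re, Complex.smul_re, smul_eq_mul]
  ring

variable [DecidableEq ι]

/-- The matrix of `K`, as a map from an eigenbasis of `A` to an eigenbasis of `B`. -/
noncomputable def eigenCoeff (hA : A.IsHermitian) (hB : B.IsHermitian) (K : Matrix ι ι ℂ) :
    Matrix ι ι ℂ :=
  (hB.eigenvectorUnitary : Matrix ι ι ℂ)ᴴ * K * (hA.eigenvectorUnitary : Matrix ι ι ℂ)

lemma eigenCoeff_add (hA : A.IsHermitian) (hB : B.IsHermitian) (X Y : Matrix ι ι ℂ) :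
    eigenCoeff hA hB (X + Y) = eigenCoeff hA hB X + eigenCoeff hA hB Y := by
  simp only [eigenCoeff, Matrix.mul_add, Matrix.add_mul]

lemma eigenCoeff_surjective (hA : A.IsHermitian) (hB : B.IsHermitian) :
    Function.Surjective (eigenCoeff hA hB) := by
  intro M
  refine ⟨(hB.eigenvectorUnitary : Matrix ι ι ℂ) * M *
    (hA.eigenvectorUnitary : Matrix ι ι ℂ)ᴴ, ?_⟩
  have hU := Unitary.coe_star_mul_self hA.eigenvectorUnitary
  have hV := Unitary.coe_star_mul_self hB.eigenvectorUnitary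
  rw [star_eq_conjTranspose] at hU hV
  simp only [eigenCoeff, Matrix.mul_assoc, hU, Matrix.mul_one]
  rw [← Matrix.mul_assoc, hV, Matrix.one_mul]

lemma eigenCoeff_injective (hA : A.IsHermitian) (hB : B.IsHermitian) :
    Function.Injective (eigenCoeff hA hB) := by
  intro X Y h
  have hU := Unitary.mul_star_self_of_mem hA.eigenvectorUnitary.2
  have hV := Unitary.mul_star_self_of_mem hB.eigenvectorUnitary.2
  rw [star_eq_conjTranspose] at hU hV
  have key (Z : Matrix ι ι ℂ) : (hB.eigenvectorUnitary : Matrix ι ι ℂ) * eigenCoeff hA hB Z *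
      (hA.eigenvectorUnitary : Matrix ι ι ℂ)ᴴ = Z := by
    simp only [eigenCoeff, Matrix.mul_assoc, hU, Matrix.mul_one]
    rw [← Matrix.mul_assoc, hV, Matrix.one_mul]
  rw [← key X, ← key Y, h]

lemma trace_diagonal_mul_conjTranspose_mul_diagonal_mul (f g : ι → ℝ) (M : Matrix ι ι ℂ) :
    ((diagonal (fun i => (f i : ℂ)) * Mᴴ * diagonal (fun j => (g j : ℂ)) * M).trace).re
      = ∑ i, ∑ j, f i * g j * Complex.normSq (M j i) := by
  simp only [Matrix.trace, Matrix.diag_apply, Matrix.mul_apply (N := M), Matrix.mul_diagonal,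
    Matrix.diagonal_mul, Matrix.conjTranspose_apply, Complex.re_sum]
  refine Finset.sum_congr rfl fun i _ => Finset.sum_congr rfl fun j _ => ?_
  have : (f i : ℂ) * star (M j i) * (g j : ℂ) * M j i
      = ((f i * g j * Complex.normSq (M j i) : ℝ) : ℂ) := by
    push_cast
    rw [Complex.normSq_eq_conj_mul_self]
    simp only [Complex.star_def]
    ring
  rw [this, Complex.ofReal_re]

lemma trace_cfc_mul_conjTranspose_mul_cfc_mul (hA : A.IsHermitian) (hB : B.IsHermitian)
    (f g : ℝ → ℝ) (K : Matrix ι ι ℂ) :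
    ((cfc f A * Kᴴ * cfc g B * K).trace).re
      = ∑ i, ∑ j, f (hA.eigenvalues i) * g (hB.eigenvalues j)
          * Complex.normSq (eigenCoeff hA hB K j i) := by
  rw [← trace_diagonal_mul_conjTranspose_mul_diagonal_mul (fun i => f (hA.eigenvalues i))
      (fun j => g (hB.eigenvalues j)), hA.cfc_eq, hB.cfc_eq, Matrix.IsHermitian.cfc,
    Matrix.IsHermitian.cfc, Unitary.conjStarAlgAut_apply, Unitary.conjStarAlgAut_apply]
  simp only [star_eq_conjTranspose, eigenCoeff, Matrix.conjTranspose_mul,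
    Matrix.conjTranspose_conjTranspose, Matrix.mul_assoc]
  rw [Matrix.trace_mul_comm]
  simp only [Matrix.mul_assoc]
  rfl

lemma splitForm_eq_sum (hA : A.IsHermitian) (hB : B.IsHermitian) (t : ℝ) (X Y : Matrix ι ι ℂ) :
    splitForm t A B X Y
      = ∑ i, ∑ j, (t⁻¹ * hA.eigenvalues i * Complex.normSq (eigenCoeff hA hB X j i)
          + hB.eigenvalues j * Complex.normSq (eigenCoeff hA hB Y j i)) := by
  have hX := trace_cfc_mul_conjTranspose_mul_cfc_mul hA hB id (fun _ => 1) X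
  have hY := trace_cfc_mul_conjTranspose_mul_cfc_mul hA hB (fun _ => 1) id Y
  rw [cfc_id ℝ A hA.isSelfAdjoint, cfc_const_one ℝ B hB.isSelfAdjoint, Matrix.mul_one] at hX
  rw [cfc_id ℝ B hB.isSelfAdjoint, cfc_const_one ℝ A hA.isSelfAdjoint, Matrix.one_mul] at hY
  rw [splitForm, hX, hY]
  simp only [Finset.mul_sum, Finset.sum_add_distrib, id, one_mul, mul_one, mul_assoc]

/-- The trace functional attached to the parallel sum `a b / (a + t b)`. -/
noncomputable def parallelForm (hA : A.IsHermitian) (hB : B.IsHermitian) (t : ℝ)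
    (K : Matrix ι ι ℂ) : ℝ :=
  ∑ i, ∑ j, hA.eigenvalues i * hB.eigenvalues j / (hA.eigenvalues i + t * hB.eigenvalues j)
    * Complex.normSq (eigenCoeff hA hB K j i)

lemma parallel_mul_normSq_add_le {a b t : ℝ} (ha : 0 < a) (hb : 0 < b) (ht : 0 < t) (x y : ℂ) :
    a * b / (a + t * b) * Complex.normSq (x + y)
      ≤ t⁻¹ * a * Complex.normSq x + b * Complex.normSq y := by
  have hd : 0 < a + t * b := by positivity
  have key : t⁻¹ * a * Complex.normSq x + b * Complex.normSq y
      - a * b / (a + t * b) * Complex.normSq (x + y)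
      = ((a * x.re - t * b * y.re) ^ 2 + (a * x.im - t * b * y.im) ^ 2) / (t * (a + t * b)) := by
    simp only [Complex.normSq_apply, Complex.add_re, Complex.add_im]
    field_simp
    ring
  rw [← sub_nonneg, key]
  positivity

lemma parallelForm_le_splitForm (hA : A.PosDef) (hB : B.PosDef) {t : ℝ} (ht : 0 < t)
    (X Y : Matrix ι ι ℂ) :
    parallelForm hA.1 hB.1 t (X + Y) ≤ splitForm t A B X Y := by
  rw [splitForm_eq_sum hA.1 hB.1, parallelForm, eigenCoeff_add]
  exact Finset.sum_le_sum fun i _ => Finset.sum_le_sum fun j _ =>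
    parallel_mul_normSq_add_le (hA.eigenvalues_pos i) (hB.eigenvalues_pos j) ht _ _

lemma exists_splitForm_eq_parallelForm (hA : A.PosDef) (hB : B.PosDef) {t : ℝ} (ht : 0 < t)
    (K : Matrix ι ι ℂ) :
    ∃ X Y, X + Y = K ∧ splitForm t A B X Y = parallelForm hA.1 hB.1 t K := by
  set a := hA.1.eigenvalues with ha
  set b := hB.1.eigenvalues with hb
  set M := eigenCoeff hA.1 hB.1 K with hM
  obtain ⟨X, hX⟩ := eigenCoeff_surjective hA.1 hB.1
    (Matrix.of fun j i => ((t * b j / (a i + t * b j) : ℝ) : ℂ) * M j i)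
  obtain ⟨Y, hY⟩ := eigenCoeff_surjective hA.1 hB.1
    (Matrix.of fun j i => ((a i / (a i + t * b j) : ℝ) : ℂ) * M j i)
  have hpos (i j : ι) : 0 < a i + t * b j :=
    add_pos (hA.eigenvalues_pos i) (mul_pos ht (hB.eigenvalues_pos j))
  refine ⟨X, Y, eigenCoeff_injective hA.1 hB.1 ?_, ?_⟩
  · rw [eigenCoeff_add, hX, hY]
    ext j i
    have h1 : t * b j / (a i + t * b j) + a i / (a i + t * b j) = 1 := by
      rw [← add_div, add_comm, div_self (hpos i j).ne']
    rw [Matrix.add_apply, Matrix.of_apply, Matrix.of_apply, ← add_mul, ← Complex.ofReal_add, h1,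
      Complex.ofReal_one, one_mul]
  · rw [splitForm_eq_sum hA.1 hB.1, parallelForm, hX, hY]
    refine Finset.sum_congr rfl fun i _ => Finset.sum_congr rfl fun j _ => ?_
    have := (hpos i j).ne'
    simp only [Matrix.of_apply, Complex.normSq_mul, Complex.normSq_ofReal, ← ha, ← hb, ← hM]
    field_simp
    ring

lemma parallelForm_concave {A₁ A₂ B₁ B₂ : Matrix ι ι ℂ} (hA₁ : A₁.PosDef) (hA₂ : A₂.PosDef)
    (hB₁ : B₁.PosDef) (hB₂ : B₂.PosDef) {c d : ℝ} (hc : 0 ≤ c) (hd : 0 ≤ d)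
    (hA : (c • A₁ + d • A₂).PosDef) (hB : (c • B₁ + d • B₂).PosDef) {t : ℝ} (ht : 0 < t)
    (K : Matrix ι ι ℂ) :
    c * parallelForm hA₁.1 hB₁.1 t K + d * parallelForm hA₂.1 hB₂.1 t K
      ≤ parallelForm hA.1 hB.1 t K := by
  obtain ⟨X, Y, rfl, hXY⟩ := exists_splitForm_eq_parallelForm hA hB ht K
  rw [← hXY, splitForm_add_smul]
  gcongr
  · exact parallelForm_le_splitForm hA₁ hB₁ ht X Y
  · exact parallelForm_le_splitForm hA₂ hB₂ ht X Y

lemma rpow_sub_one_mul_parallel_eq {s a b t : ℝ} (hs : s ∈ Ioo (0 : ℝ) 1) (ha : 0 < a)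
    (hb : 0 < b) (ht : 0 < t) :
    t ^ (s - 1) * (a * b / (a + t * b)) = b * rpowIntegrand₀₁ s t (a / b) := by
  rw [rpowIntegrand₀₁_eq_pow_div hs ht.le (by positivity)]
  have : a + t * b ≠ 0 := by positivity
  have : t + a / b ≠ 0 := by positivity
  field_simp
  ring

lemma rpow_mul_rpow_one_sub {s a b : ℝ} (ha : 0 < a) (hb : 0 < b) :
    a ^ s * b ^ (1 - s) = b * (a / b) ^ s := by
  rw [Real.div_rpow ha.le hb.le, Real.rpow_sub hb, Real.rpow_one]
  ring

lemma integral_parallelForm {s : ℝ} (hs : s ∈ Ioo (0 : ℝ) 1) {μ : Measure ℝ}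
    (hμ : ∀ x ∈ Ici (0 : ℝ), IntegrableOn (fun t => rpowIntegrand₀₁ s t x) (Ioi 0) μ
      ∧ x ^ s = ∫ t in Ioi 0, rpowIntegrand₀₁ s t x ∂μ)
    (hA : A.PosDef) (hB : B.PosDef) (K : Matrix ι ι ℂ) :
    IntegrableOn (fun t => t ^ (s - 1) * parallelForm hA.1 hB.1 t K) (Ioi 0) μ ∧
      ((cfc (fun x : ℝ => x ^ s) A * Kᴴ * cfc (fun x : ℝ => x ^ (1 - s)) B * K).trace).re
        = ∫ t in Ioi 0, t ^ (s - 1) * parallelForm hA.1 hB.1 t K ∂μ := by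
  set a := hA.1.eigenvalues with ha
  set b := hB.1.eigenvalues with hb
  set M := eigenCoeff hA.1 hB.1 K with hM
  have hquot (i j : ι) : a i / b j ∈ Ici (0 : ℝ) :=
    (div_pos (hA.eigenvalues_pos i) (hB.eigenvalues_pos j)).le
  have hEq : EqOn (fun t => ∑ i, ∑ j, b j * rpowIntegrand₀₁ s t (a i / b j)
      * Complex.normSq (M j i)) (fun t => t ^ (s - 1) * parallelForm hA.1 hB.1 t K) (Ioi 0) := by
    intro t ht
    simp only [parallelForm, Finset.mul_sum]
    refine Finset.sum_congr rfl fun i _ => Finset.sum_congr rfl fun j _ => ?_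
    rw [← mul_assoc, rpow_sub_one_mul_parallel_eq hs (hA.eigenvalues_pos i)
      (hB.eigenvalues_pos j) ht]
  have hint (i j : ι) : Integrable (fun t => b j * rpowIntegrand₀₁ s t (a i / b j)
      * Complex.normSq (M j i)) (μ.restrict (Ioi 0)) :=
    ((hμ _ (hquot i j)).1.const_mul _).mul_const _
  constructor
  · exact IntegrableOn.congr_fun
      (integrable_finsetSum _ fun i _ => integrable_finsetSum _ fun j _ => hint i j)
      hEq measurableSet_Ioi
  · rw [← setIntegral_congr_fun measurableSet_Ioi hEq,
      integral_finsetSum _ fun i _ => integrable_finsetSum _ fun j _ => hint i j,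
      trace_cfc_mul_conjTranspose_mul_cfc_mul hA.1 hB.1]
    refine Finset.sum_congr rfl fun i _ => ?_
    rw [integral_finsetSum _ fun j _ => hint i j]
    refine Finset.sum_congr rfl fun j _ => ?_
    rw [integral_mul_const, integral_const_mul, ← (hμ _ (hquot i j)).2,
      rpow_mul_rpow_one_sub (hA.eigenvalues_pos i) (hB.eigenvalues_pos j)]

end LiebConcavity

/-- Lieb's concavity theorem: for `0 < s < 1` and a fixed matrix `K`, the function
`(A, B) ↦ Trace (Aˢ K* B¹⁻ˢ K)` is jointly concave on pairs of positive definite matrices. -/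
theorem lieb_concavity {n : ℕ} (s : ℝ) (hs0 : 0 < s) (hs1 : s < 1)
    (K : Matrix (Fin n) (Fin n) ℂ)
    (A₁ A₂ B₁ B₂ : Matrix (Fin n) (Fin n) ℂ)
    (hA₁ : A₁.PosDef) (hA₂ : A₂.PosDef) (hB₁ : B₁.PosDef) (hB₂ : B₂.PosDef)
    (c : ℝ) (hc0 : 0 ≤ c) (hc1 : c ≤ 1) :
    ((matrixRpow (c • A₁ + (1 - c) • A₂) s * Kᴴ
        * matrixRpow (c • B₁ + (1 - c) • B₂) (1 - s) * K).trace).re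
      ≥ c * ((matrixRpow A₁ s * Kᴴ * matrixRpow B₁ (1 - s) * K).trace).re
        + (1 - c) * ((matrixRpow A₂ s * Kᴴ * matrixRpow B₂ (1 - s) * K).trace).re := by
  have hs : s ∈ Set.Ioo (0 : ℝ) 1 := ⟨hs0, hs1⟩
  have hA := LiebConcavity.posDef_convex_combination hA₁ hA₂ hc0 hc1
  have hB := LiebConcavity.posDef_convex_combination hB₁ hB₂ hc0 hc1
  obtain ⟨μ, hμ⟩ := Real.exists_measure_rpow_eq_integral_rpowIntegrand₀₁ hs
  obtain ⟨hint, heq⟩ := LiebConcavity.integral_parallelForm hs hμ hA hB K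
  obtain ⟨hint₁, heq₁⟩ := LiebConcavity.integral_parallelForm hs hμ hA₁ hB₁ K
  obtain ⟨hint₂, heq₂⟩ := LiebConcavity.integral_parallelForm hs hμ hA₂ hB₂ K
  unfold matrixRpow
  rw [heq, heq₁, heq₂, ← MeasureTheory.integral_const_mul, ← MeasureTheory.integral_const_mul,
    ← MeasureTheory.integral_add (hint₁.const_mul c) (hint₂.const_mul (1 - c))]
  refine MeasureTheory.setIntegral_mono_on ((hint₁.const_mul c).add (hint₂.const_mul (1 - c))) hint
    measurableSet_Ioi fun t ht => ?_
  have h := mul_le_mul_of_nonneg_left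
    (LiebConcavity.parallelForm_concave hA₁ hA₂ hB₁ hB₂ hc0 (sub_nonneg.2 hc1) hA hB ht K)
    (Real.rpow_nonneg (Set.mem_Ioi.1 ht).le (s - 1))
  linarith
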